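/- Let V₁, …, V_s be ℚ-linear subspaces of ℚ^m with ℚ^m = V₁ ⊕ ⋯ ⊕ V_s. For each i let W_i be the ℝ-linear span of V_i in ℝ^m and Λ_i = W_i ∩ ℤ^m. Then the group homomorphism from the product (W₁/Λ₁) × ⋯ × (W_s/Λ_s) to ℝ^m/ℤ^m induced by the sum map (w₁, …, w_s) ↦ w₁ + ⋯ + w_s is surjective and has finite kernel. -/

import Mathlib

open scoped Matrix

def castHom (m : ℕ) : (Fin m → ℤ) →+ (Fin m → ℝ) :=
  AddMonoidHom.mk' (fun v i => (v i : ℝ)) (by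
    intro a b; funext i; simp)

def intLattice (m : ℕ) : AddSubgroup (Fin m → ℝ) := (castHom m).range

abbrev RealTorus (m : ℕ) := (Fin m → ℝ) ⧸ intLattice m

def torusPi (m : ℕ) : (Fin m → ℝ) →+ RealTorus m := QuotientAddGroup.mk' (intLattice m)

def realMat {m : ℕ} (A : Matrix (Fin m) (Fin m) ℤ) : Matrix (Fin m) (Fin m) ℝ :=
  A.map (Int.cast : ℤ → ℝ)

lemma realMat_lattice {m : ℕ} (A : Matrix (Fin m) (Fin m) ℤ) :
    intLattice m ≤ (intLattice m).comap (realMat A).mulVecLin.toAddMonoidHom := by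
  rintro v ⟨w, rfl⟩
  refine ⟨A.mulVec w, ?_⟩
  funext i
  show (Int.castRingHom ℝ) ((A *ᵥ w) i) = ((realMat A).mulVecLin (castHom m w)) i
  rw [Matrix.mulVecLin_apply, RingHom.map_mulVec (Int.castRingHom ℝ) A w i]
  rfl

noncomputable def torusAct {m : ℕ} (A : GL (Fin m) ℤ) : RealTorus m →+ RealTorus m :=
  QuotientAddGroup.map _ _ (realMat (A : Matrix (Fin m) (Fin m) ℤ)).mulVecLin.toAddMonoidHom
    (realMat_lattice _)

/-- An internal direct sum over a finite index type has a system of linear projections. -/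
lemma DirectSum.IsInternal.exists_projections {R M ι : Type*} [CommRing R] [AddCommGroup M]
    [Module R M] [Fintype ι] [DecidableEq ι] {V : ι → Submodule R M}
    (hV : DirectSum.IsInternal V) :
    ∃ p : ι → M →ₗ[R] M, (∀ i x, p i x ∈ V i) ∧ (∀ x, ∑ i, p i x = x) ∧
      (∀ i, ∀ x ∈ V i, p i x = x) ∧ ∀ i j, i ≠ j → ∀ x ∈ V i, p j x = 0 := by
  let := hV.chooseDecomposition
  refine ⟨fun i => (V i).subtype ∘ₗ DirectSum.component R ι (fun i => V i) i ∘ₗ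
    (DirectSum.decomposeLinearEquiv V).toLinearMap, fun i x => SetLike.coe_mem _, fun x => ?_,
    fun i x hx => DirectSum.decompose_of_mem_same V hx,
    fun i j hij x hx => DirectSum.decompose_of_mem_ne V hx hij⟩
  show ∑ i, (DirectSum.decompose V x i : M) = x
  induction x using DirectSum.Decomposition.inductionOn V with
  | zero => simp
  | @homogeneous i y =>
    rw [Finset.sum_eq_single i]
    · exact DirectSum.decompose_of_mem_same V y.2
    · exact fun j _ hj => DirectSum.decompose_of_mem_ne V y.2 hj.symm
    · simp
  | add x y hx hy => simp [Finset.sum_add_distrib, hx, hy]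

/-- A rational matrix, viewed as an endomorphism of real vectors. -/
noncomputable def ratMatToReal {m : ℕ} (A : Matrix (Fin m) (Fin m) ℚ) :
    (Fin m → ℝ) →ₗ[ℝ] (Fin m → ℝ) :=
  (A.map (Rat.castHom ℝ)).mulVecLin

lemma ratMatToReal_cast {m : ℕ} (A : Matrix (Fin m) (Fin m) ℚ) (q : Fin m → ℚ) :
    ratMatToReal A (fun j => (q j : ℝ)) = fun j => (((A *ᵥ q) j : ℚ) : ℝ) := by
  funext j
  exact (RingHom.map_mulVec (Rat.castHom ℝ) A q j).symm

lemma span_ratCast_eq_top (m : ℕ) :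
    Submodule.span ℝ (Set.range fun (q : Fin m → ℚ) (j : Fin m) => (q j : ℝ)) = ⊤ := by
  rw [eq_top_iff, ← (Pi.basisFun ℝ (Fin m)).span_eq, Submodule.span_le]
  rintro _ ⟨i, rfl⟩
  refine Submodule.subset_span ⟨Pi.single i 1, ?_⟩
  funext j
  by_cases h : j = i
  · subst h; simp
  · simp [h]

/-- The projections of an internal direct sum of rational subspaces, over the reals. -/
lemma exists_ratMat_projections {m s : ℕ} {V : Fin s → Submodule ℚ (Fin m → ℚ)}
    (hV : DirectSum.IsInternal V) {W : Fin s → Submodule ℝ (Fin m → ℝ)}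
    (hW : ∀ i, W i = Submodule.span ℝ
      ((fun q : Fin m → ℚ => (fun j => (q j : ℝ))) '' (V i : Set (Fin m → ℚ)))) :
    ∃ A : Fin s → Matrix (Fin m) (Fin m) ℚ, (∀ i x, ratMatToReal (A i) x ∈ W i) ∧
      (∀ x, ∑ i, ratMatToReal (A i) x = x) ∧
      ∀ w : ∀ i, W i, ∀ i, ratMatToReal (A i) (∑ j, (w j : Fin m → ℝ)) = w i := by
  obtain ⟨p, hmem, hsum, hsame, hne⟩ := hV.exists_projections
  have hA (i : Fin s) (q : Fin m → ℚ) : ratMatToReal (LinearMap.toMatrix' (p i))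
      (fun j => (q j : ℝ)) = fun j => ((p i q j : ℚ) : ℝ) := by
    rw [ratMatToReal_cast, LinearMap.toMatrix'_mulVec]
  refine ⟨fun i => LinearMap.toMatrix' (p i), fun i x => ?_, fun x => ?_, fun w i => ?_⟩
  · have hx : x ∈ Submodule.span ℝ
        (Set.range fun (q : Fin m → ℚ) (j : Fin m) => (q j : ℝ)) := by
      rw [span_ratCast_eq_top]; trivial
    refine (Submodule.span_le (p := (W i).comap _)).2 ?_ hx
    rintro _ ⟨q, rfl⟩
    simp only [SetLike.mem_coe, Submodule.mem_comap, hA, hW]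
    exact Submodule.subset_span ⟨_, hmem i q, rfl⟩
  · have h : ∑ i, ratMatToReal (LinearMap.toMatrix' (p i)) = LinearMap.id := by
      refine LinearMap.ext_on (span_ratCast_eq_top m) ?_
      rintro _ ⟨q, rfl⟩
      funext j
      simp only [LinearMap.sum_apply, hA, LinearMap.id_apply, Finset.sum_apply]
      exact_mod_cast (Finset.sum_apply j _ _).symm.trans (congrFun (hsum q) j)
    simpa using LinearMap.congr_fun h x
  · have hW' (j : Fin s) (f : (Fin m → ℝ) →ₗ[ℝ] (Fin m → ℝ))
        (hf : ∀ q ∈ V j, f (fun k => (q k : ℝ)) = 0) (x : W j) : f x = 0 := by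
      have hx : (x : Fin m → ℝ) ∈ Submodule.span ℝ _ := (hW j).le x.2
      refine (Submodule.span_le (p := LinearMap.ker f)).2 ?_ hx
      rintro _ ⟨q, hq, rfl⟩
      exact hf q hq
    rw [map_sum, Finset.sum_eq_single i]
    · rw [← sub_eq_zero]
      refine hW' i (ratMatToReal (LinearMap.toMatrix' (p i)) - LinearMap.id) (fun q hq => ?_) (w i)
      simp [hA, hsame i q hq]
    · intro j _ hj
      refine hW' j _ (fun q hq => ?_) (w j)
      rw [hA, hne j i hj q hq]
      funext k
      simp
    · simp

/-- Finitely many rational matrices have a common denominator. -/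
lemma exists_pos_ratMatToReal_mem_intLattice {m s : ℕ}
    (A : Fin s → Matrix (Fin m) (Fin m) ℚ) :
    ∃ N : ℤ, 0 < N ∧ ∀ i z, ratMatToReal (A i) (castHom m (N • z)) ∈ intLattice m := by
  obtain ⟨b, hb⟩ := IsLocalization.exist_integer_multiples_of_finite (nonZeroDivisors ℤ)
    (fun k : Fin s × Fin m × Fin m => A k.1 k.2.1 k.2.2)
  choose B hB using hb
  have hB' (i : Fin s) (j k : Fin m) : (B (i, j, k) : ℝ) = (b : ℤ) * (A i j k : ℝ) := by
    have h := hB (i, j, k)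
    simp only [zsmul_eq_mul, eq_intCast] at h
    exact_mod_cast congrArg (Rat.cast : ℚ → ℝ) h
  refine ⟨|(b : ℤ)|, abs_pos.2 (nonZeroDivisors.ne_zero b.2), fun i z => ?_⟩
  have key : ratMatToReal (A i) (castHom m ((b : ℤ) • z)) ∈ intLattice m := by
    refine ⟨fun j => ∑ k, B (i, j, k) * z k, ?_⟩
    funext j
    simp [castHom, ratMatToReal, Matrix.mulVec, dotProduct, hB']
    exact Finset.sum_congr rfl fun k _ => by ring
  rcases abs_choice (b : ℤ) with h | h <;> rw [h]
  · exact key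
  · rw [neg_smul, map_neg, map_neg]
    exact neg_mem key

/-- Given a direct-sum decomposition `ℚ^m = V₁ ⊕ ⋯ ⊕ V_s` into `ℚ`-subspaces, with
`W i` the real span of `V i` in `ℝ^m` and `Λ i = W i ∩ ℤ^m`, the homomorphism
`(W₁/Λ₁) × ⋯ × (W_s/Λ_s) → ℝ^m/ℤ^m` induced by the sum map is surjective with finite
kernel. -/
theorem sum_map_isogeny
    (m s : ℕ) (V : Fin s → Submodule ℚ (Fin m → ℚ)) (hV : DirectSum.IsInternal V)
    (W : Fin s → Submodule ℝ (Fin m → ℝ))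
    (hW : ∀ i, W i = Submodule.span ℝ
      ((fun q : Fin m → ℚ => (fun j => (q j : ℝ))) '' (V i : Set (Fin m → ℚ))))
    (Λ : ∀ i, AddSubgroup (W i))
    (hΛ : ∀ i, Λ i = (intLattice m).comap ((W i).subtype.toAddMonoidHom))
    (f : (∀ i, (W i) ⧸ Λ i) →+ RealTorus m)
    (hf : ∀ w : ∀ i, W i,
      f (fun i => QuotientAddGroup.mk (w i)) = torusPi m (∑ i, (w i : Fin m → ℝ))) :
    Function.Surjective f ∧ (f.ker : Set (∀ i, (W i) ⧸ Λ i)).Finite := by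
  obtain ⟨A, hmem, hsum, hproj⟩ := exists_ratMat_projections hV hW
  refine ⟨fun x => ?_, ?_⟩
  · obtain ⟨x, rfl⟩ := QuotientAddGroup.mk_surjective x
    refine ⟨fun i => QuotientAddGroup.mk ⟨_, hmem i x⟩, ?_⟩
    rw [hf]
    simp only [hsum]
    rfl
  · obtain ⟨N, hN, hAN⟩ := exists_pos_ratMatToReal_mem_intLattice A
    let g : (Fin m → ℤ) → ∀ i, W i ⧸ Λ i := fun z i =>
      QuotientAddGroup.mk ⟨ratMatToReal (A i) (castHom m z), hmem i _⟩
    refine ((Set.finite_Icc (0 : Fin m → ℤ) (fun _ => N)).image g).subset fun y hy => ?_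
    choose w hw using fun i => QuotientAddGroup.mk_surjective (y i)
    obtain rfl : (fun i => QuotientAddGroup.mk (w i)) = y := funext hw
    have hy' : torusPi m (∑ i, (w i : Fin m → ℝ)) = 0 := (hf w).symm.trans hy
    obtain ⟨z, hz⟩ : ∑ i, (w i : Fin m → ℝ) ∈ intLattice m :=
      (QuotientAddGroup.eq_zero_iff _).1 hy'
    refine ⟨fun j => z j % N, ⟨fun j => Int.emod_nonneg _ hN.ne',
      fun j => (Int.emod_lt_of_pos _ hN).le⟩, ?_⟩
    funext i
    rw [QuotientAddGroup.eq, hΛ]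
    show -ratMatToReal (A i) (castHom m fun j => z j % N) + (w i : Fin m → ℝ) ∈ intLattice m
    rw [← hproj w i, ← hz, neg_add_eq_sub, ← map_sub, ← map_sub]
    convert hAN i (fun j => z j / N) using 3
    funext j
    have := Int.mul_ediv_add_emod (z j) N
    simp only [Pi.sub_apply, Pi.smul_apply, smul_eq_mul]
    linarith
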